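/- Let u be a solution of the IVP that changes sign, with first zero z₁, let v be the variation associated with u, and let r₁ ∈ (0, z₁) be the unique point with u(r₁) = 1. Then there exists τ₁ ∈ (0, r₁) such that v(r) > 0 on [0, τ₁), v(τ₁) = 0, and v(r) < 0 on (τ₁, z₁]. -/

import Mathlib

open Real Filter Set

/-- The nonlinearity `f(s) = -s + |s|^(p-1) s`. -/
noncomputable def f (p s : ℝ) : ℝ := -s + |s| ^ (p - 1) * s

/-- The derivative of the nonlinearity, `f'(s) = -1 + p |s|^(p-1)`. -/
noncomputable def fder (p s : ℝ) : ℝ := -1 + p * |s| ^ (p - 1)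

/-- The primitive `F(s) = -s^2/2 + |s|^(p+1)/(p+1)`. -/
noncomputable def F (p s : ℝ) : ℝ := -s ^ 2 / 2 + |s| ^ (p + 1) / (p + 1)

/-- `u : [0,∞) → ℝ` (modeled on `Set.Ici 0`) is a C² solution of the IVP
`u'' + ((n-1)/r) u' + f(u) = 0`, `u(0) = α`, `u'(0) = 0`; the data `u'`, `u''`
are its first and second derivatives on `[0,∞)`. -/
structure IsSolution (n : ℕ) (p α : ℝ) (u u' u'' : ℝ → ℝ) : Prop where
  init : u 0 = α
  initDeriv : u' 0 = 0
  hasDeriv1 : ∀ r ∈ Set.Ici (0:ℝ), HasDerivWithinAt u (u' r) (Set.Ici 0) r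
  hasDeriv2 : ∀ r ∈ Set.Ici (0:ℝ), HasDerivWithinAt u' (u'' r) (Set.Ici 0) r
  cont2 : ContinuousOn u'' (Set.Ici 0)
  ode : ∀ r : ℝ, 0 < r → u'' r + ((n : ℝ) - 1) / r * u' r + f p (u r) = 0

/-- The variation `v` associated with a solution `u`: the C² solution of the linearized
equation `v'' + ((n-1)/r) v' + f'(u) v = 0`, `v(0) = 1`, `v'(0) = 0`. -/
structure IsVariation (n : ℕ) (p : ℝ) (u v v' v'' : ℝ → ℝ) : Prop where
  init : v 0 = 1
  initDeriv : v' 0 = 0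
  hasDeriv1 : ∀ r ∈ Set.Ici (0:ℝ), HasDerivWithinAt v (v' r) (Set.Ici 0) r
  hasDeriv2 : ∀ r ∈ Set.Ici (0:ℝ), HasDerivWithinAt v' (v'' r) (Set.Ici 0) r
  cont2 : ContinuousOn v'' (Set.Ici 0)
  ode : ∀ r : ℝ, 0 < r → v'' r + ((n : ℝ) - 1) / r * v' r + fder p (u r) * v r = 0

/-- `u` is decaying: `u(r) → 0` and `u'(r) → 0` as `r → ∞`. -/
def Decaying (u u' : ℝ → ℝ) : Prop :=
  Filter.Tendsto u Filter.atTop (nhds 0) ∧ Filter.Tendsto u' Filter.atTop (nhds 0)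

/-- `u` changes sign on `(0,∞)`. -/
def ChangesSign (u : ℝ → ℝ) : Prop :=
  (∃ r : ℝ, 0 < r ∧ u r < 0) ∧ (∃ r : ℝ, 0 < r ∧ 0 < u r)

/-- `z 0 < z 1 < ⋯ < z (k-1)` are exactly the zeros of `u` in `(0,∞)`. -/
def ExactZeros (u : ℝ → ℝ) (k : ℕ) (z : Fin k → ℝ) : Prop :=
  StrictMono z ∧ (∀ i, 0 < z i ∧ u (z i) = 0) ∧
    ∀ r : ℝ, 0 < r → u r = 0 → ∃ i, r = z i

section Calculus

theorem lt_of_hasDerivAt_pos {g g' : ℝ → ℝ} {a b : ℝ} (hab : a < b)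
    (hc : ContinuousOn g (Icc a b)) (hd : ∀ x ∈ Ioo a b, HasDerivAt g (g' x) x)
    (hpos : ∀ x ∈ Ioo a b, 0 < g' x) : g a < g b := by
  obtain ⟨x, hx, he⟩ := exists_hasDerivAt_eq_slope g g' hab hc hd
  have h := hpos x hx
  rw [he] at h
  have := (div_pos_iff_of_pos_right (sub_pos.2 hab)).1 h
  linarith

theorem le_of_hasDerivAt_nonneg {g g' : ℝ → ℝ} {a b : ℝ} (hab : a ≤ b)
    (hc : ContinuousOn g (Icc a b)) (hd : ∀ x ∈ Ioo a b, HasDerivAt g (g' x) x)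
    (hpos : ∀ x ∈ Ioo a b, 0 ≤ g' x) : g a ≤ g b := by
  rcases hab.eq_or_lt with rfl | hab
  · exact le_rfl
  obtain ⟨x, hx, he⟩ := exists_hasDerivAt_eq_slope g g' hab hc hd
  have h := hpos x hx
  rw [he, div_nonneg_iff] at h
  rcases h with h | h <;> linarith

theorem exists_first_zero {g : ℝ → ℝ} {a b : ℝ} (hab : a ≤ b)
    (hc : ContinuousOn g (Icc a b)) (ha : 0 < g a) (hb : g b ≤ 0) :
    ∃ c, a < c ∧ c ≤ b ∧ g c = 0 ∧ ∀ x, a ≤ x → x < c → 0 < g x := by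
  have hcl : IsClosed (Icc a b ∩ g ⁻¹' Iic 0) :=
    hc.preimage_isClosed_of_isClosed isClosed_Icc isClosed_Iic
  have hcomp : IsCompact (Icc a b ∩ g ⁻¹' Iic 0) :=
    isCompact_Icc.of_isClosed_subset hcl inter_subset_left
  obtain ⟨c, ⟨⟨hac, hcb⟩, hgc⟩, hleast⟩ := hcomp.exists_isLeast ⟨b, ⟨hab, le_rfl⟩, hb⟩
  have hgc : g c ≤ 0 := hgc
  obtain ⟨d, ⟨had, hdc⟩, hd⟩ := intermediate_value_Icc' hac (hc.mono (Icc_subset_Icc_right hcb))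
    (⟨hgc, ha.le⟩ : (0 : ℝ) ∈ Icc (g c) (g a))
  have hcd : c = d := le_antisymm (hleast ⟨⟨had, hdc.trans hcb⟩, hd.le⟩) hdc
  subst hcd
  refine ⟨c, lt_of_le_of_ne hac ?_, hcb, hd, fun x hax hxc => ?_⟩
  · rintro rfl
    exact ha.ne' hd
  · by_contra! hx
    exact absurd (hleast ⟨⟨hax, hxc.le.trans hcb⟩, hx⟩) (not_le.2 hxc)

theorem hasDerivAt_nonpos_of_pos_left {g : ℝ → ℝ} {a c d : ℝ} (hac : a < c)
    (hd : HasDerivAt g d c) (hc : g c = 0) (hpos : ∀ x, a < x → x < c → 0 < g x) : d ≤ 0 := by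
  by_contra! h
  rw [← hd.deriv] at h
  have hev := eventually_nhdsWithin_sign_eq_of_deriv_pos h hc
  have hmem : ∀ᶠ x in nhdsWithin c (Iio c), a < x ∧ x < c := Ioo_mem_nhdsLT hac
  obtain ⟨x, hx, hax, hxc⟩ := ((hev.filter_mono nhdsWithin_le_nhds).and hmem).exists
  rw [sign_pos (hpos x hax hxc), sign_neg (sub_neg.2 hxc)] at hx
  exact absurd hx (by decide)

theorem exists_neg_right_of_hasDerivAt_neg {g : ℝ → ℝ} {c d b : ℝ} (hcb : c < b)
    (hd : HasDerivAt g d c) (hc : g c = 0) (hneg : d < 0) :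
    ∃ e, c < e ∧ e < b ∧ ∀ x, c < x → x ≤ e → g x < 0 := by
  rw [← hd.deriv] at hneg
  have hev := eventually_nhdsWithin_sign_eq_of_deriv_neg hneg hc
  obtain ⟨ε, hε, hball⟩ := Metric.eventually_nhds_iff.1 hev
  refine ⟨c + min (ε / 2) ((b - c) / 2), ?_, ?_, fun x hcx hxe => ?_⟩
  · have : 0 < min (ε / 2) ((b - c) / 2) := lt_min (by linarith) (by linarith)
    linarith
  · have := min_le_right (ε / 2) ((b - c) / 2)
    linarith
  · have := min_le_left (ε / 2) ((b - c) / 2)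
    have hx := hball (show dist x c < ε by
      rw [Real.dist_eq, abs_of_pos (sub_pos.2 hcx)]; linarith)
    rw [sign_neg (sub_neg.2 hcx)] at hx
    exact sign_eq_neg_one_iff.1 hx

/-- The Lagrange identity for the radial operator `a ↦ a'' + ((m+1)/r) a' + q a`. -/
theorem hasDerivAt_radial_wronskian {m : ℕ} {a a₁ b b₁ : ℝ → ℝ} {r q ℓ A B : ℝ} (hr : 0 < r)
    (ha : HasDerivAt a (a₁ r) r) (ha₁ : HasDerivAt a₁ A r)
    (hb : HasDerivAt b (b₁ r) r) (hb₁ : HasDerivAt b₁ B r)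
    (hA : A + ((m : ℝ) + 1) / r * a₁ r + q * a r = ℓ)
    (hB : B + ((m : ℝ) + 1) / r * b₁ r + q * b r = 0) :
    HasDerivAt (fun x => x ^ (m + 1) * (a x * b₁ x - a₁ x * b x))
      (-(r ^ (m + 1) * b r * ℓ)) r := by
  have h := (hasDerivAt_pow (m + 1) r).mul ((ha.mul hb₁).sub (ha₁.mul hb))
  refine h.congr_deriv ?_
  have hB' : B = -(((m : ℝ) + 1) / r * b₁ r) - q * b r := by linarith
  subst hA
  rw [hB']
  simp only [Pi.mul_apply, Pi.sub_apply, Nat.cast_add, Nat.cast_one, Nat.add_sub_cancel]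
  field_simp
  ring

end Calculus

section Nonlinearity

variable {p s : ℝ}

theorem hasDerivAt_abs_rpow_of_pos (hs : 0 < s) (q : ℝ) :
    HasDerivAt (fun x : ℝ => |x| ^ q) (q * |s| ^ (q - 1)) s := by
  have h := Real.hasDerivAt_rpow_const (p := q) (Or.inl hs.ne')
  rw [abs_of_pos hs]
  refine h.congr_of_eventuallyEq ?_
  filter_upwards [lt_mem_nhds hs] with x hx
  rw [abs_of_pos hx]

theorem continuous_f (hp : 1 < p) : Continuous (f p) := by
  unfold f
  have : Continuous fun s : ℝ => |s| ^ (p - 1) :=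
    continuous_abs.rpow_const fun _ => Or.inr (by linarith)
  fun_prop

theorem continuous_F (hp : 1 < p) : Continuous (F p) := by
  unfold F
  have : Continuous fun s : ℝ => |s| ^ (p + 1) :=
    continuous_abs.rpow_const fun _ => Or.inr (by linarith)
  fun_prop

theorem hasDerivAt_f (hs : 0 < s) : HasDerivAt (f p) (fder p s) s := by
  have h := (hasDerivAt_neg s).add ((hasDerivAt_abs_rpow_of_pos hs (p - 1)).mul (hasDerivAt_id s))
  refine h.congr_deriv ?_
  have : |s| ^ (p - 1) = |s| ^ (p - 1 - 1) * s := by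
    rw [abs_of_pos hs, Real.rpow_sub_one hs.ne' (p - 1)]
    field_simp
  simp only [fder, id]
  rw [mul_assoc, ← this]
  ring

theorem F_eq (hs : 0 < s) :
    F p s = -s ^ 2 / 2 + |s| ^ (p - 1) * s ^ 2 / (p + 1) := by
  have : |s| ^ (p + 1) = |s| ^ (p - 1) * s ^ 2 := by
    rw [abs_of_pos hs, ← Real.rpow_natCast s 2, ← Real.rpow_add hs]
    norm_num
    ring_nf
  rw [F, this]

theorem F_zero (hp : 1 < p) : F p 0 = 0 := by
  simp [F, Real.zero_rpow (show p + 1 ≠ 0 by linarith)]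

theorem hasDerivAt_F (hp : 1 < p) (hs : 0 < s) : HasDerivAt (F p) (f p s) s := by
  have h := ((hasDerivAt_pow 2 s).neg.div_const 2).add
    ((hasDerivAt_abs_rpow_of_pos hs (p + 1)).div_const (p + 1))
  refine h.congr_deriv ?_
  have h1 : |s| ^ (p + 1 - 1) = |s| ^ (p - 1) * s := by
    rw [abs_of_pos hs, Real.rpow_sub_one hs.ne' p, add_sub_cancel_right]
    field_simp
  have : p + 1 ≠ 0 := by linarith
  rw [h1, f]
  field_simp
  push_cast
  ring

theorem F_neg (hp : 1 < p) (hs : 0 < s) (hs1 : s ≤ 1) : F p s < 0 := by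
  rw [F_eq hs]
  have h1 : |s| ^ (p - 1) ≤ 1 := by
    rw [abs_of_pos hs]
    exact Real.rpow_le_one hs.le hs1 (by linarith)
  have h2 : |s| ^ (p - 1) * s ^ 2 / (p + 1) < s ^ 2 / 2 := by
    have : 0 < s ^ 2 := by positivity
    rw [div_lt_div_iff₀ (by linarith) two_pos]
    nlinarith
  linarith

theorem two_mul_F_lt (hp : 1 < p) (hs : 0 < s) : 2 * F p s < s * f p s := by
  have h0 : 0 < |s| ^ (p - 1) := Real.rpow_pos_of_pos (abs_pos.2 hs.ne') _
  have h : |s| ^ (p - 1) * s ^ 2 / (p + 1) < |s| ^ (p - 1) * s ^ 2 / 2 :=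
    div_lt_div_of_pos_left (by positivity) two_pos (by linarith)
  rw [F_eq hs, f]
  linarith

theorem f_pos (hp : 1 < p) (hs : 1 < s) : 0 < f p s := by
  have h : 1 < |s| ^ (p - 1) := by
    rw [abs_of_pos (by linarith)]
    exact Real.one_lt_rpow hs (by linarith)
  rw [f]
  nlinarith

theorem f_lt_fder_mul_sub_one (hp : 1 < p) (hs : 1 < s) : f p s < fder p s * (s - 1) := by
  have hs0 : 0 < s := by linarith
  have hb := one_add_mul_self_lt_rpow_one_add (s := s⁻¹ - 1)
    (by have := inv_pos.2 hs0; linarith) (by have := inv_lt_one_of_one_lt₀ hs; linarith) hp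
  rw [add_sub_cancel, Real.inv_rpow hs0.le] at hb
  have hsp : s ^ p = s ^ (p - 1) * s := by
    rw [Real.rpow_sub_one hs0.ne']
    field_simp
  have h0 : 0 < s ^ (p - 1) := Real.rpow_pos_of_pos hs0 _
  rw [hsp] at hb
  have h := mul_lt_mul_of_pos_right hb (mul_pos h0 hs0)
  rw [inv_mul_cancel₀ (by positivity)] at h
  have h2 : (1 + p * (s⁻¹ - 1)) * (s ^ (p - 1) * s)
      = s ^ (p - 1) * s + p * (s ^ (p - 1) - s ^ (p - 1) * s) := by
    field_simp
  rw [h2] at h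
  rw [f, fder, abs_of_pos hs0]
  linarith

end Nonlinearity

section Solution

variable {m : ℕ} {p α : ℝ} {u u' u'' v v' v'' : ℝ → ℝ}

theorem IsSolution.continuousOn (hu : IsSolution (m + 2) p α u u' u'') :
    ContinuousOn u (Ici 0) := fun r hr => (hu.hasDeriv1 r hr).continuousWithinAt

theorem IsSolution.continuousOn_deriv (hu : IsSolution (m + 2) p α u u' u'') :
    ContinuousOn u' (Ici 0) := fun r hr => (hu.hasDeriv2 r hr).continuousWithinAt

theorem IsSolution.hasDerivAt (hu : IsSolution (m + 2) p α u u' u'') {r : ℝ} (hr : 0 < r) :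
    HasDerivAt u (u' r) r := (hu.hasDeriv1 r hr.le).hasDerivAt (Ici_mem_nhds hr)

theorem IsSolution.hasDerivAt_deriv (hu : IsSolution (m + 2) p α u u' u'') {r : ℝ} (hr : 0 < r) :
    HasDerivAt u' (-(((m : ℝ) + 1) / r * u' r) - f p (u r)) r := by
  refine ((hu.hasDeriv2 r hr.le).hasDerivAt (Ici_mem_nhds hr)).congr_deriv ?_
  have h := hu.ode r hr
  push_cast at h
  rw [show (m : ℝ) + 2 - 1 = m + 1 by ring] at h
  linarith

theorem IsVariation.continuousOn (hv : IsVariation (m + 2) p u v v' v'') :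
    ContinuousOn v (Ici 0) := fun r hr => (hv.hasDeriv1 r hr).continuousWithinAt

theorem IsVariation.continuousOn_deriv (hv : IsVariation (m + 2) p u v v' v'') :
    ContinuousOn v' (Ici 0) := fun r hr => (hv.hasDeriv2 r hr).continuousWithinAt

theorem IsVariation.hasDerivAt (hv : IsVariation (m + 2) p u v v' v'') {r : ℝ} (hr : 0 < r) :
    HasDerivAt v (v' r) r := (hv.hasDeriv1 r hr.le).hasDerivAt (Ici_mem_nhds hr)

theorem IsVariation.hasDerivAt_deriv (hv : IsVariation (m + 2) p u v v' v'') {r : ℝ}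
    (hr : 0 < r) :
    HasDerivAt v' (-(((m : ℝ) + 1) / r * v' r) - fder p (u r) * v r) r := by
  refine ((hv.hasDeriv2 r hr.le).hasDerivAt (Ici_mem_nhds hr)).congr_deriv ?_
  have h := hv.ode r hr
  push_cast at h
  rw [show (m : ℝ) + 2 - 1 = m + 1 by ring] at h
  linarith

theorem IsSolution.pos_of_lt_first_zero (hu : IsSolution (m + 2) p α u u' u'') (hα : 0 < α)
    {z : ℝ} (hfirst : ∀ r : ℝ, 0 < r → r < z → u r ≠ 0) {r : ℝ} (hr : 0 ≤ r) (hrz : r < z) :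
    0 < u r := by
  by_contra! h
  obtain ⟨c, hc, hcr, hc0, -⟩ := exists_first_zero hr
    (hu.continuousOn.mono Icc_subset_Ici_self) (by rwa [hu.init]) h
  exact hfirst c hc (hcr.trans_lt hrz) hc0

/-- The energy `u'²/2 + F(u)` is nonincreasing, hence nonnegative up to a zero of `u`. -/
theorem IsSolution.energy_nonneg (hu : IsSolution (m + 2) p α u u' u'') (hp : 1 < p)
    {z : ℝ} (hz : u z = 0) (hpos : ∀ r, 0 ≤ r → r < z → 0 < u r) {r : ℝ} (hr : 0 ≤ r)
    (hrz : r ≤ z) : 0 ≤ u' r ^ 2 / 2 + F p (u r) := by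
  have hsub : Icc r z ⊆ Ici 0 := fun x hx => hr.trans hx.1
  have hcu := hu.continuousOn.mono hsub
  have hcu' := hu.continuousOn_deriv.mono hsub
  have h := le_of_hasDerivAt_nonneg (g := fun x => -(u' x ^ 2 / 2 + F p (u x)))
    (g' := fun x => ((m : ℝ) + 1) / x * u' x ^ 2) hrz
    (((hcu'.pow 2).div_const 2).add ((continuous_F hp).comp_continuousOn hcu)).neg
    (fun x hx => by
      have hx0 : 0 < x := hr.trans_lt hx.1
      have h := ((((hu.hasDerivAt_deriv hx0).pow 2).div_const 2).add
        ((hasDerivAt_F hp (hpos x hx0.le hx.2)).comp x (hu.hasDerivAt hx0))).neg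
      refine h.congr_deriv ?_
      push_cast
      ring)
    (fun x hx => by
      have hx0 : 0 < x := hr.trans_lt hx.1
      positivity)
  simp only [hz, F_zero hp] at h
  nlinarith [sq_nonneg (u' z)]

theorem IsSolution.one_lt_of_deriv_eq_zero (hu : IsSolution (m + 2) p α u u' u'') (hp : 1 < p)
    {z : ℝ} (hz : u z = 0) (hpos : ∀ r, 0 ≤ r → r < z → 0 < u r) {r : ℝ} (hr : 0 ≤ r)
    (hrz : r < z) (hd : u' r = 0) : 1 < u r := by
  by_contra! h
  have h1 := hu.energy_nonneg hp hz hpos hr hrz.le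
  have h2 := F_neg hp (hpos r hr hrz) h
  rw [hd] at h1
  linarith

theorem IsSolution.deriv_neg_of_one_lt (hu : IsSolution (m + 2) p α u u' u'') (hp : 1 < p)
    {r : ℝ} (hr : 0 < r) (h1 : ∀ x, 0 < x → x < r → 1 < u x) : u' r < 0 := by
  have h := lt_of_hasDerivAt_pos (g := fun x => -(x ^ (m + 1) * u' x))
    (g' := fun x => x ^ (m + 1) * f p (u x)) hr
    (((continuousOn_id.pow (m + 1)).mul
      (hu.continuousOn_deriv.mono Icc_subset_Ici_self)).neg)
    (fun x hx => by
      have hx0 : 0 < x := hx.1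
      refine ((hasDerivAt_pow (m + 1) x).mul (hu.hasDerivAt_deriv hx0)).neg.congr_deriv ?_
      simp only [Nat.cast_add, Nat.cast_one, Nat.add_sub_cancel]
      field_simp
      ring)
    (fun x hx => mul_pos (pow_pos hx.1 _) (f_pos hp (h1 x hx.1 hx.2)))
  simp only [hu.initDeriv, mul_zero, neg_zero] at h
  by_contra! hr'
  have := mul_nonneg (pow_pos hr (m + 1)).le hr'
  linarith

theorem IsSolution.deriv_neg (hu : IsSolution (m + 2) p α u u' u'') (hp : 1 < p)
    {z r₁ : ℝ} (hz : u z = 0) (hpos : ∀ r, 0 ≤ r → r < z → 0 < u r) (hr₁ : 0 < r₁)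
    (hgt : ∀ r, 0 ≤ r → r < r₁ → 1 < u r) (hle : ∀ r, r₁ ≤ r → r ≤ z → u r ≤ 1)
    {r : ℝ} (hr : 0 < r) (hrz : r < z) : u' r < 0 := by
  rcases le_or_gt r r₁ with h | h
  · exact hu.deriv_neg_of_one_lt hp hr fun x hx hxr => hgt x hx.le (hxr.trans_le h)
  · by_contra! hd
    have h1 := hu.deriv_neg_of_one_lt hp hr₁ fun x hx hxr => hgt x hx.le hxr
    obtain ⟨c, hc, hcr, hc0, -⟩ := exists_first_zero (g := fun x => -u' x) h.le
      (hu.continuousOn_deriv.mono fun x hx => hr₁.le.trans hx.1).neg (by linarith) (by linarith)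
    have := hu.one_lt_of_deriv_eq_zero hp hz hpos (hr₁.trans hc).le (hcr.trans_lt hrz)
      (neg_eq_zero.1 hc0)
    linarith [hle c hc.le (hcr.trans hrz.le)]

theorem IsSolution.lt_of_lt (hu : IsSolution (m + 2) p α u u' u'') {z : ℝ}
    (hneg : ∀ r, 0 < r → r < z → u' r < 0) {a b : ℝ} (ha : 0 ≤ a) (hab : a < b) (hbz : b ≤ z) :
    u b < u a := by
  have h := lt_of_hasDerivAt_pos (g := fun x => -u x) (g' := fun x => -u' x) hab
    (hu.continuousOn.mono fun x hx => ha.trans hx.1).neg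
    (fun x hx => (hu.hasDerivAt (ha.trans_lt hx.1)).neg)
    (fun x hx => neg_pos.2 (hneg x (ha.trans_lt hx.1) (hx.2.trans_le hbz)))
  linarith

/-- The Pohozaev functional of a subcritical solution is nonnegative up to the first zero. -/
theorem IsSolution.pohozaev_nonneg (hu : IsSolution (m + 2) p α u u' u'') (hp : 1 < p)
    (hsub : 0 < 2 * ((m : ℝ) + 2) / (p + 1) - m) {z : ℝ} (hz : u z = 0)
    (hpos : ∀ r, 0 ≤ r → r < z → 0 < u r) (hneg : ∀ r, 0 < r → r < z → u' r < 0)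
    {r : ℝ} (hr : 0 < r) (hrz : r < z) :
    0 ≤ r ^ (m + 2) * (u' r ^ 2 + 2 * F p (u r)) + m * (r ^ (m + 1) * (u r * u' r)) := by
  set κ : ℝ := 2 * ((m : ℝ) + 2) / (p + 1) - m with hκ
  set P : ℝ → ℝ := fun x =>
    x ^ (m + 2) * (u' x ^ 2 + 2 * F p (u x)) + m * (x ^ (m + 1) * (u x * u' x)) with hP
  set P' : ℝ → ℝ := fun x => x ^ (m + 1) * (u x ^ 2 * (κ * |u x| ^ (p - 1) - 2)) with hP'
  have hcont : ContinuousOn P (Ici 0) := by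
    have h1 := hu.continuousOn
    have h2 := hu.continuousOn_deriv
    have h3 := (continuous_F hp).comp_continuousOn h1
    exact ((continuousOn_id.pow _).mul ((h2.pow 2).add (h3.const_mul 2))).add
      (((continuousOn_id.pow _).mul (h1.mul h2)).const_mul _)
  have hderiv : ∀ x, 0 < x → x < z → HasDerivAt P (P' x) x := by
    intro x hx hxz
    have h1 := hu.hasDerivAt hx
    have h2 := hu.hasDerivAt_deriv hx
    have h3 := (hasDerivAt_F hp (hpos x hx.le hxz)).comp x h1
    have h := ((hasDerivAt_pow (m + 2) x).mul ((h2.pow 2).add (h3.const_mul 2))).add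
      (((hasDerivAt_pow (m + 1) x).mul (h1.mul h2)).const_mul (m : ℝ))
    refine h.congr_deriv ?_
    have hp1 : p + 1 ≠ 0 := by linarith
    simp only [hP', hκ, Pi.mul_apply, Pi.add_apply, Pi.pow_apply, Function.comp_apply,
      Nat.cast_add, Nat.cast_one, Nat.cast_ofNat, Nat.add_sub_cancel,
      show m + 2 - 1 = m + 1 from rfl, F_eq (hpos x hx.le hxz), f]
    field_simp
    ring
  have hanti : ∀ x y, 0 < x → x ≤ y → y < z → |u y| ^ (p - 1) ≤ |u x| ^ (p - 1) := by
    intro x y hx hxy hyz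
    rcases hxy.eq_or_lt with rfl | hxy
    · exact le_rfl
    have h := hu.lt_of_lt hneg hx.le hxy hyz.le
    have hy := hpos y (hx.trans hxy).le hyz
    rw [abs_of_pos hy, abs_of_pos (hy.trans h)]
    exact Real.rpow_le_rpow hy.le h.le (by linarith)
  change 0 ≤ P r
  rcases le_or_gt 2 (κ * |u r| ^ (p - 1)) with h | h
  · have h0 : P 0 = 0 := by simp [hP]
    rw [← h0]
    refine le_of_hasDerivAt_nonneg hr.le (hcont.mono Icc_subset_Ici_self)
      (fun x hx => hderiv x hx.1 (hx.2.trans hrz)) fun x hx => ?_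
    have := mul_le_mul_of_nonneg_left (hanti x r hx.1 hx.2.le hrz) hsub.le
    exact mul_nonneg (pow_pos hx.1 _).le (mul_nonneg (sq_nonneg _) (by linarith))
  · have h1 : 0 ≤ P z := by
      have : P z = z ^ (m + 2) * u' z ^ 2 := by simp [hP, hz, F_zero hp]
      rw [this]
      have := hr.trans hrz
      positivity
    have h2 := le_of_hasDerivAt_nonneg (g := fun x => -P x) (g' := fun x => -P' x) hrz.le
      (hcont.mono fun x hx => hr.le.trans hx.1).neg
      (fun x hx => (hderiv x (hr.trans hx.1) hx.2).neg) fun x hx => by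
        have hx0 := hr.trans hx.1
        have := mul_le_mul_of_nonneg_left (hanti r x hr hx.1.le hx.2) hsub.le
        have h3 : u x ^ 2 * (κ * |u x| ^ (p - 1) - 2) ≤ 0 :=
          mul_nonpos_of_nonneg_of_nonpos (sq_nonneg _) (by linarith)
        exact neg_nonneg.2 (mul_nonpos_of_nonneg_of_nonpos (pow_pos hx0 _).le h3)
    linarith

/-- For a subcritical solution, `-r u'(r) / u(r)` increases up to the first zero. -/
theorem IsSolution.neg_mul_deriv_div_lt (hu : IsSolution (m + 2) p α u u' u'') (hp : 1 < p)
    (hsub : 0 < 2 * ((m : ℝ) + 2) / (p + 1) - m) {z : ℝ} (hz : u z = 0)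
    (hpos : ∀ r, 0 ≤ r → r < z → 0 < u r) (hneg : ∀ r, 0 < r → r < z → u' r < 0)
    {a b : ℝ} (ha : 0 < a) (hab : a < b) (hbz : b < z) :
    -(a * u' a) / u a < -(b * u' b) / u b := by
  have hderiv : ∀ x, 0 < x → x < z → HasDerivAt (fun x => -(x * u' x) / u x)
      ((x * u' x ^ 2 + m * (u x * u' x) + x * (u x * f p (u x))) / u x ^ 2) x := by
    intro x hx hxz
    have hux := hpos x hx.le hxz
    have h := (((hasDerivAt_id x).mul (hu.hasDerivAt_deriv hx)).neg).div (hu.hasDerivAt hx) hux.ne'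
    refine h.congr_deriv ?_
    simp only [Pi.mul_apply, Pi.neg_apply, id]
    field_simp
    ring
  refine lt_of_hasDerivAt_pos hab
    (fun x hx =>
      (hderiv x (ha.trans_le hx.1) (hx.2.trans_lt hbz)).continuousAt.continuousWithinAt)
    (fun x hx => hderiv x (ha.trans hx.1) (hx.2.trans hbz)) fun x hx => ?_
  have hx0 := ha.trans hx.1
  have hxz := hx.2.trans hbz
  have hux := hpos x hx0.le hxz
  have hP := hu.pohozaev_nonneg hp hsub hz hpos hneg hx0 hxz
  have hF := mul_pos (pow_pos hx0 (m + 2)) (sub_pos.2 (two_mul_F_lt hp hux))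
  refine div_pos (pos_of_mul_pos_right (a := x ^ (m + 1)) ?_ (pow_pos hx0 _).le) (by positivity)
  have : x ^ (m + 1) * (x * u' x ^ 2 + m * (u x * u' x) + x * (u x * f p (u x)))
      = (x ^ (m + 2) * (u' x ^ 2 + 2 * F p (u x)) + m * (x ^ (m + 1) * (u x * u' x)))
        + x ^ (m + 2) * (u x * f p (u x) - 2 * F p (u x)) := by ring
  rw [this]
  linarith

theorem IsVariation.exists_zero (hv : IsVariation (m + 2) p u v v' v'')
    (hu : IsSolution (m + 2) p α u u' u'') (hp : 1 < p) {r₁ : ℝ} (hr₁ : 0 < r₁)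
    (hur₁ : u r₁ = 1) (hgt : ∀ r, 0 ≤ r → r < r₁ → 1 < u r) :
    ∃ r, 0 < r ∧ r < r₁ ∧ v r = 0 := by
  by_contra! hne
  have hvpos : ∀ r, 0 ≤ r → r < r₁ → 0 < v r := by
    intro r hr hrr
    by_contra! h
    obtain ⟨c, hc, hcr, hc0, -⟩ := exists_first_zero hr
      (hv.continuousOn.mono Icc_subset_Ici_self) (by rw [hv.init]; exact one_pos) h
    exact hne c hc (hcr.trans_lt hrr) hc0
  have hv₁ : 0 ≤ v r₁ := by
    by_contra! h
    obtain ⟨c, hc, hcr, hc0, -⟩ := exists_first_zero hr₁.le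
      (hv.continuousOn.mono Icc_subset_Ici_self) (by rw [hv.init]; exact one_pos) h.le
    rcases hcr.eq_or_lt with rfl | hcr
    · exact h.ne hc0
    · exact hne c hc hcr hc0
  have hcu := hu.continuousOn
  have hcu' := hu.continuousOn_deriv
  have hcont : ContinuousOn
      (fun x => x ^ (m + 1) * ((u x - 1) * v' x - u' x * v x)) (Ici 0) :=
    (continuousOn_id.pow _).mul (((hcu.sub continuousOn_const).mul hv.continuousOn_deriv).sub
      (hcu'.mul hv.continuousOn))
  have h := lt_of_hasDerivAt_pos
    (g := fun x => -(x ^ (m + 1) * ((u x - 1) * v' x - u' x * v x)))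
    (g' := fun x => - -(x ^ (m + 1) * v x * (fder p (u x) * (u x - 1) - f p (u x)))) hr₁
    (hcont.mono Icc_subset_Ici_self).neg
    (fun x hx => (hasDerivAt_radial_wronskian (a := fun y => u y - 1) hx.1
      ((hu.hasDerivAt hx.1).sub_const 1) (hu.hasDerivAt_deriv hx.1)
      (hv.hasDerivAt hx.1) (hv.hasDerivAt_deriv hx.1) (q := fder p (u x))
      (by ring) (by ring)).neg)
    (fun x hx => by
      have h1 := hvpos x hx.1.le hx.2
      have h2 := sub_pos.2 (f_lt_fder_mul_sub_one hp (hgt x hx.1.le hx.2))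
      have h3 : 0 < x := hx.1
      rw [neg_neg]
      positivity)
  have hd := hu.deriv_neg_of_one_lt hp hr₁ fun x hx hxr => hgt x hx.le hxr
  have h1 := mul_nonneg (pow_pos hr₁ (m + 1)).le (mul_nonneg (neg_pos.2 hd).le hv₁)
  simp only [hur₁, ne_eq, Nat.add_eq_zero_iff, one_ne_zero, and_false, not_false_eq_true,
    zero_pow, zero_mul, neg_zero, sub_self] at h
  linarith

/-- The Wronskian of `r u' + c u` and the variation, with `u''` eliminated by the equation. -/
theorem IsVariation.hasDerivAt_wronskian (hv : IsVariation (m + 2) p u v v' v'')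
    (hu : IsSolution (m + 2) p α u u' u'') (c : ℝ) {r : ℝ} (hr : 0 < r) (hur : 0 < u r) :
    HasDerivAt (fun x => x ^ (m + 1) *
        ((x * u' x + c * u x) * v' x - ((c - m) * u' x - x * f p (u x)) * v x))
      (-(r ^ (m + 1) * v r * (u r * ((c * (p - 1) - 2) * |u r| ^ (p - 1) + 2)))) r := by
  have h1 := hu.hasDerivAt hr
  have h2 := hu.hasDerivAt_deriv hr
  have h3 := (hasDerivAt_f (p := p) hur).comp r h1
  have hw : HasDerivAt (fun x => x * u' x + c * u x) ((c - m) * u' r - r * f p (u r)) r := by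
    refine (((hasDerivAt_id r).mul h2).add (h1.const_mul c)).congr_deriv ?_
    simp only [id]
    field_simp
    ring
  refine hasDerivAt_radial_wronskian (a₁ := fun x => (c - m) * u' x - x * f p (u x)) hr hw
    ((h2.const_mul (c - m)).sub ((hasDerivAt_id r).mul h3)) (hv.hasDerivAt hr)
    (hv.hasDerivAt_deriv hr) (q := fder p (u r)) ?_ (by ring)
  simp only [id, f, fder]
  field_simp
  ring

end Solution

/-- for a nodal solution with first zero `z₁`, the variation `v` has a unique
sign change `τ₁` before `r₁` (where `u(r₁) = 1`), and stays negative up to `z₁`. -/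
theorem statement17 (n : ℕ) (hn : 3 ≤ n) (p : ℝ) (hp1 : 1 < p)
    (hp2 : p < ((n : ℝ) + 2) / ((n : ℝ) - 2))
    (α : ℝ) (hα : 0 < α)
    (u u' u'' v v' v'' : ℝ → ℝ)
    (hu : IsSolution n p α u u' u'') (hv : IsVariation n p u v v' v'')
    (hsign : ChangesSign u)
    (z₁ : ℝ) (hz₁ : 0 < z₁) (hz₁0 : u z₁ = 0)
    (hfirst : ∀ r : ℝ, 0 < r → r < z₁ → u r ≠ 0)
    (r₁ : ℝ) (hr₁ : 0 < r₁) (hr₁z : r₁ < z₁) (hur₁ : u r₁ = 1)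
    (huniq : ∀ r : ℝ, 0 < r → r < z₁ → u r = 1 → r = r₁) :
    ∃ τ₁ : ℝ, 0 < τ₁ ∧ τ₁ < r₁ ∧
      (∀ r : ℝ, 0 ≤ r → r < τ₁ → 0 < v r) ∧ v τ₁ = 0 ∧
      (∀ r : ℝ, τ₁ < r → r ≤ z₁ → v r < 0) := by
  obtain ⟨m, rfl⟩ : ∃ m, n = m + 2 := ⟨n - 2, by omega⟩
  have hm : (1 : ℝ) ≤ m := by exact_mod_cast (by omega : 1 ≤ m)
  have hsub : 0 < 2 * ((m : ℝ) + 2) / (p + 1) - m := by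
    push_cast at hp2
    rw [show (m : ℝ) + 2 - 2 = m by ring, lt_div_iff₀ (by linarith)] at hp2
    rw [sub_pos, lt_div_iff₀ (by linarith)]
    linarith
  have hpos : ∀ r, 0 ≤ r → r < z₁ → 0 < u r := fun r => hu.pos_of_lt_first_zero hα hfirst
  have hcu := hu.continuousOn
  have hcv := hv.continuousOn
  have hα1 : 1 < u 0 := hu.one_lt_of_deriv_eq_zero hp1 hz₁0 hpos le_rfl hz₁ hu.initDeriv
  have hgt : ∀ r, 0 ≤ r → r < r₁ → 1 < u r := by
    intro r hr hrr
    by_contra! h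
    obtain ⟨c, hc, hcr, hc0, -⟩ := exists_first_zero (g := fun x => u x - 1) hr
      ((hcu.mono Icc_subset_Ici_self).sub continuousOn_const) (by linarith) (by linarith)
    linarith [huniq c hc (by linarith) (by linarith)]
  have hle : ∀ r, r₁ ≤ r → r ≤ z₁ → u r ≤ 1 := by
    intro r hr hrz
    by_contra! h
    obtain ⟨c, hc, hcz, hc0, -⟩ := exists_first_zero (g := fun x => u x - 1) hrz
      ((hcu.mono fun x hx => hr₁.le.trans (hr.trans hx.1)).sub continuousOn_const)
      (by linarith) (by linarith)
    have hcz' : c ≠ z₁ := by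
      rintro rfl
      linarith
    linarith [huniq c (by linarith) (lt_of_le_of_ne hcz hcz') (by linarith)]
  have hneg : ∀ r, 0 < r → r < z₁ → u' r < 0 := fun r =>
    hu.deriv_neg hp1 hz₁0 hpos hr₁ hgt hle
  have hnegz : u' z₁ ≤ 0 :=
    hasDerivAt_nonpos_of_pos_left hz₁ (hu.hasDerivAt hz₁) hz₁0 fun x hx => hpos x hx.le
  obtain ⟨t, ht, htr, hvt⟩ := hv.exists_zero hu hp1 hr₁ hur₁ hgt
  obtain ⟨τ, hτ, hτt, hvτ, hvpos⟩ := exists_first_zero ht.le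
    (hcv.mono Icc_subset_Ici_self) (by rw [hv.init]; exact one_pos) hvt.le
  have hτr : τ < r₁ := hτt.trans_lt htr
  have hτz : τ < z₁ := hτr.trans hr₁z
  have huτ := hpos τ hτ.le hτz
  -- choose `c` so that the source term of `r u' + c u` changes sign exactly at `τ`
  set k : ℝ := |u τ| ^ (p - 1) with hk
  have hk0 : 0 < k := Real.rpow_pos_of_pos (abs_pos.2 huτ.ne') _
  obtain ⟨c, hc⟩ : ∃ c : ℝ, c * (p - 1) - 2 = -(2 / k) := by
    refine ⟨(2 - 2 / k) / (p - 1), ?_⟩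
    have : p - 1 ≠ 0 := by linarith
    field_simp
    ring
  have hmono : ∀ x y, 0 ≤ x → x < y → y < z₁ → |u y| ^ (p - 1) < |u x| ^ (p - 1) := by
    intro x y hx hxy hyz
    have h := hu.lt_of_lt hneg hx hxy hyz.le
    have hy := hpos y (hx.trans hxy.le) hyz
    rw [abs_of_pos hy, abs_of_pos (hy.trans h)]
    exact Real.rpow_lt_rpow hy.le h (by linarith)
  have hsource_eq : ∀ x, u x * ((c * (p - 1) - 2) * |u x| ^ (p - 1) + 2)
      = 2 * u x * (k - |u x| ^ (p - 1)) / k := by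
    intro x
    rw [hc]
    field_simp
    ring
  set G : ℝ → ℝ := fun x => x ^ (m + 1) *
    ((x * u' x + c * u x) * v' x - ((c - m) * u' x - x * f p (u x)) * v x) with hG
  have hGcont : ContinuousOn G (Ici 0) := by
    have h2 := hu.continuousOn_deriv
    have h3 := (continuous_f hp1).comp_continuousOn hcu
    exact (continuousOn_id.pow _).mul ((((continuousOn_id.mul h2).add (hcu.const_mul c)).mul
      hv.continuousOn_deriv).sub (((h2.const_mul _).sub (continuousOn_id.mul h3)).mul hcv))
  have hG0 : G 0 = 0 := by simp [hG]
  have hGzero : ∀ x, v x = 0 → G x = x ^ (m + 1) * ((x * u' x + c * u x) * v' x) := by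
    intro x hx
    simp [hG, hx]
  have hGτ : 0 < G τ := by
    rw [← hG0]
    refine lt_of_hasDerivAt_pos hτ (hGcont.mono Icc_subset_Ici_self)
      (fun x hx => hv.hasDerivAt_wronskian hu c hx.1 (hpos x hx.1.le (hx.2.trans hτz)))
      fun x hx => ?_
    have hx0 : 0 < x := hx.1
    have h1 := hvpos x hx0.le hx.2
    have h2 := hpos x hx0.le (hx.2.trans hτz)
    have h3 := sub_pos.2 (hmono x τ hx0.le hx.2 hτz)
    rw [hsource_eq, show -(x ^ (m + 1) * v x * (2 * u x * (k - |u x| ^ (p - 1)) / k))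
      = x ^ (m + 1) * v x * (2 * u x * (|u x| ^ (p - 1) - k) / k) by ring]
    positivity
  have hv'τ : v' τ ≤ 0 :=
    hasDerivAt_nonpos_of_pos_left hτ (hv.hasDerivAt hτ) hvτ fun x hx => hvpos x hx.le
  have hwτ : 0 < (τ * u' τ + c * u τ) * v' τ := by
    rw [hGzero τ hvτ] at hGτ
    exact pos_of_mul_pos_right hGτ (pow_pos hτ _).le
  have hv'τ : v' τ < 0 := lt_of_le_of_ne hv'τ fun h => by simp [h] at hwτ
  have hwτ : τ * u' τ + c * u τ < 0 := by
    by_contra! h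
    linarith [mul_nonpos_of_nonneg_of_nonpos h hv'τ.le]
  refine ⟨τ, hτ, hτr, hvpos, hvτ, fun r hτr' hrz => ?_⟩
  by_contra! hvr
  obtain ⟨e, hτe, her, hve⟩ :=
    exists_neg_right_of_hasDerivAt_neg hτr' (hv.hasDerivAt hτ) hvτ hv'τ
  obtain ⟨σ, heσ, hσr, hvσ, hvneg⟩ := exists_first_zero (g := fun x => -v x) her.le
    (hcv.mono fun x hx => (hτ.trans hτe).le.trans hx.1).neg
    (by linarith [hve e hτe le_rfl]) (by linarith)
  have hvσ : v σ = 0 := neg_eq_zero.1 hvσ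
  have hτσ : τ < σ := hτe.trans heσ
  have hσ : 0 < σ := hτ.trans hτσ
  have hσz : σ ≤ z₁ := hσr.trans hrz
  have hvneg : ∀ x, τ < x → x < σ → 0 < -v x := fun x hx hxσ =>
    (le_or_gt e x).elim (fun h => hvneg x h hxσ) fun h => neg_pos.2 (hve x hx h.le)
  have hv'σ : -v' σ ≤ 0 :=
    hasDerivAt_nonpos_of_pos_left hτσ (hv.hasDerivAt hσ).neg (by simp [hvσ]) hvneg
  have hGσ : G τ < G σ := by
    refine lt_of_hasDerivAt_pos hτσ (hGcont.mono fun x hx => hτ.le.trans hx.1)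
      (fun x hx => hv.hasDerivAt_wronskian hu c (hτ.trans hx.1)
        (hpos x (hτ.trans hx.1).le (hx.2.trans_le hσz)))
      fun x hx => ?_
    have hx0 : 0 < x := hτ.trans hx.1
    have h1 := hvneg x hx.1 hx.2
    have h2 := hpos x hx0.le (hx.2.trans_le hσz)
    have h3 := sub_pos.2 (hmono τ x hτ.le hx.1 (hx.2.trans_le hσz))
    rw [hsource_eq, show -(x ^ (m + 1) * v x * (2 * u x * (k - |u x| ^ (p - 1)) / k))
      = x ^ (m + 1) * -v x * (2 * u x * (k - |u x| ^ (p - 1)) / k) by ring]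
    positivity
  have hwσ : 0 < (σ * u' σ + c * u σ) * v' σ := by
    have h := hGτ.trans hGσ
    rw [hGzero σ hvσ] at h
    exact pos_of_mul_pos_right h (pow_pos hσ _).le
  have hwσ : 0 < σ * u' σ + c * u σ := pos_of_mul_pos_left hwσ (by linarith)
  rcases hσz.eq_or_lt with rfl | hσz
  · rw [hz₁0, mul_zero, add_zero] at hwσ
    linarith [mul_nonpos_of_nonneg_of_nonpos hσ.le hnegz]
  · have h := hu.neg_mul_deriv_div_lt hp1 hsub hz₁0 hpos hneg hτ hτσ hσz
    have huσ := hpos σ hσ.le hσz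
    have h1 : c < -(τ * u' τ) / u τ := by
      rw [lt_div_iff₀ huτ]
      linarith
    have h2 : -(σ * u' σ) / u σ < c := by
      rw [div_lt_iff₀ huσ]
      linarith
    linarith
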